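/- Let L be a connected solvable unimodular Lie subgroup of the Poincaré group O(1,n) ⋉ ℝ^{n+1} acting simply transitively on ℝ^{n+1}. Then the linear part of L fixes a nonzero vector: there exists v ∈ ℝ^{n+1}, v ≠ 0, with A v = v for all (A,b) ∈ L; equivalently, L preserves the nonzero constant vector field v on ℝ^{n+1}. -/

import Mathlib

noncomputable section

open Matrix

/-- The Lorentzian bilinear form of signature `(1,n)` on `ℝ^{n+1}`:
`B(x,y) = -x₀y₀ + x₁y₁ + ⋯ + xₙyₙ`. -/
def lorentzB (n : ℕ) (x y : Fin (n + 1) → ℝ) : ℝ :=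
  -(x 0 * y 0) + ∑ i : Fin n, x i.succ * y i.succ

/-- The Lorentz group `O(1,n)`: the subgroup of `GL_{n+1}(ℝ)` preserving the Lorentzian
form `lorentzB n`. -/
def LorentzO (n : ℕ) : Subgroup (GL (Fin (n + 1)) ℝ) where
  carrier := {A | ∀ x y : Fin (n + 1) → ℝ,
    lorentzB n ((A : Matrix (Fin (n + 1)) (Fin (n + 1)) ℝ).mulVec x)
      ((A : Matrix (Fin (n + 1)) (Fin (n + 1)) ℝ).mulVec y) = lorentzB n x y}
  mul_mem' := by
    intro a b ha hb x y
    simp only [Units.val_mul, ← Matrix.mulVec_mulVec]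
    rw [ha, hb]
  one_mem' := by
    intro x y
    simp [Matrix.one_mulVec]
  inv_mem' := by
    intro a ha x y
    have h1 : ∀ v : Fin (n + 1) → ℝ,
        (a : Matrix (Fin (n + 1)) (Fin (n + 1)) ℝ).mulVec
          ((↑a⁻¹ : Matrix (Fin (n + 1)) (Fin (n + 1)) ℝ).mulVec v) = v := by
      intro v
      rw [Matrix.mulVec_mulVec, ← Units.val_mul, mul_inv_cancel]
      simp [Matrix.one_mulVec]
    conv_rhs => rw [← h1 x, ← h1 y]
    rw [ha]

/-- The Poincaré group `O(1,n) ⋉ ℝ^{n+1}`, as pairs (linear part, translation part) with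
composition of affine maps `x ↦ Ax + b` as multiplication. -/
structure Poincare (n : ℕ) where
  lin : ↥(LorentzO n)
  tr : Fin (n + 1) → ℝ

namespace Poincare

variable {n : ℕ}

theorem ext' {a b : Poincare n} (h1 : a.lin = b.lin) (h2 : a.tr = b.tr) : a = b := by
  cases a; cases b; cases h1; cases h2; rfl

/-- The matrix of the linear part. -/
def matOf (g : ↥(LorentzO n)) : Matrix (Fin (n + 1)) (Fin (n + 1)) ℝ :=
  ((g : GL (Fin (n + 1)) ℝ) : Matrix (Fin (n + 1)) (Fin (n + 1)) ℝ)

/-- The matrix of the linear part of a Poincaré transformation. -/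
def mat (g : Poincare n) : Matrix (Fin (n + 1)) (Fin (n + 1)) ℝ := matOf g.lin

lemma matOf_mul (a b : ↥(LorentzO n)) : matOf (a * b) = matOf a * matOf b := rfl

lemma matOf_one : matOf (1 : ↥(LorentzO n)) = 1 := rfl

lemma matOf_inv_mul (a : ↥(LorentzO n)) (v : Fin (n + 1) → ℝ) :
    (matOf a⁻¹).mulVec ((matOf a).mulVec v) = v := by
  rw [Matrix.mulVec_mulVec, ← matOf_mul, inv_mul_cancel, matOf_one, Matrix.one_mulVec]

instance : Mul (Poincare n) := ⟨fun g h => ⟨g.lin * h.lin, g.tr + (matOf g.lin).mulVec h.tr⟩⟩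
instance : One (Poincare n) := ⟨⟨1, 0⟩⟩
instance : Inv (Poincare n) := ⟨fun g => ⟨g.lin⁻¹, -(matOf g.lin⁻¹).mulVec g.tr⟩⟩

@[simp] lemma mul_lin (g h : Poincare n) : (g * h).lin = g.lin * h.lin := rfl
@[simp] lemma mul_tr (g h : Poincare n) : (g * h).tr = g.tr + (matOf g.lin).mulVec h.tr := rfl
@[simp] lemma one_lin : (1 : Poincare n).lin = 1 := rfl
@[simp] lemma one_tr : (1 : Poincare n).tr = 0 := rfl
@[simp] lemma inv_lin (g : Poincare n) : g⁻¹.lin = g.lin⁻¹ := rfl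
@[simp] lemma inv_tr (g : Poincare n) : g⁻¹.tr = -(matOf g.lin⁻¹).mulVec g.tr := rfl

instance : Group (Poincare n) where
  mul_assoc a b c := by
    refine ext' (mul_assoc _ _ _) ?_
    simp [matOf_mul, ← Matrix.mulVec_mulVec, Matrix.mulVec_add, add_assoc]
  one_mul a := by
    refine ext' (one_mul _) ?_
    simp [matOf_one, Matrix.one_mulVec]
  mul_one a := by
    refine ext' (mul_one _) ?_
    simp
  inv_mul_cancel a := by
    refine ext' (inv_mul_cancel _) ?_
    simp

instance : TopologicalSpace (Poincare n) :=
  TopologicalSpace.induced (fun g => (g.lin, g.tr)) inferInstance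

/-- The affine action of the Poincaré group on `ℝ^{n+1}`: `(A,b) • x = Ax + b`. -/
instance : MulAction (Poincare n) (Fin (n + 1) → ℝ) where
  smul g x := g.mat.mulVec x + g.tr
  one_smul x := by
    show (1 : Poincare n).mat.mulVec x + (1 : Poincare n).tr = x
    simp [mat, matOf_one, Matrix.one_mulVec]
  mul_smul g h x := by
    show (g * h).mat.mulVec x + (g * h).tr =
      g.mat.mulVec (h.mat.mulVec x + h.tr) + g.tr
    simp only [mat, mul_lin, mul_tr, matOf_mul, ← Matrix.mulVec_mulVec, Matrix.mulVec_add]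
    module

lemma smul_def (g : Poincare n) (x : Fin (n + 1) → ℝ) : g • x = g.mat.mulVec x + g.tr := rfl

end Poincare

section

open Filter Topology

namespace lorentzB

variable {n : ℕ} (x y z : Fin (n + 1) → ℝ) (c : ℝ)

lemma symm : lorentzB n x y = lorentzB n y x := by
  simp [lorentzB, mul_comm]

lemma add_left : lorentzB n (x + y) z = lorentzB n x z + lorentzB n y z := by
  simp only [lorentzB, Pi.add_apply, add_mul, Finset.sum_add_distrib]; ring

lemma smul_left : lorentzB n (c • x) y = c * lorentzB n x y := by
  simp only [lorentzB, Pi.smul_apply, smul_eq_mul, mul_add, Finset.mul_sum, mul_assoc]; ring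

lemma add_right : lorentzB n x (y + z) = lorentzB n x y + lorentzB n x z := by
  rw [symm, add_left, symm y, symm z]

lemma smul_right : lorentzB n x (c • y) = c * lorentzB n x y := by
  rw [symm, smul_left, symm]

lemma sub_left : lorentzB n (x - y) z = lorentzB n x z - lorentzB n y z := by
  simp only [lorentzB, Pi.sub_apply, sub_mul, Finset.sum_sub_distrib]; ring

lemma sub_right : lorentzB n x (y - z) = lorentzB n x y - lorentzB n x z := by
  rw [symm, sub_left, symm y, symm z]

lemma zero_left : lorentzB n 0 y = 0 := by simp [lorentzB]

/-- The Lorentzian form as a continuous bilinear map. -/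
def toCLM (n : ℕ) : (Fin (n + 1) → ℝ) →L[ℝ] (Fin (n + 1) → ℝ) →L[ℝ] ℝ :=
  LinearMap.toContinuousLinearMap
    (LinearMap.toContinuousLinearMap.toLinearMap ∘ₗ
      LinearMap.mk₂ ℝ (lorentzB n) add_left (fun c x y => smul_left x y c) add_right
        (fun c x y => smul_right x y c))

@[simp] lemma toCLM_apply : toCLM n x y = lorentzB n x y := rfl

lemma single_zero_right : lorentzB n x (Pi.single 0 1) = -x 0 := by
  simp [lorentzB]

lemma single_succ_right (i : Fin n) : lorentzB n x (Pi.single i.succ 1) = x i.succ := by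
  simp [lorentzB, Pi.single_apply]

variable {x y} in
lemma ext_right (h : ∀ z, lorentzB n x z = lorentzB n y z) : x = y := by
  funext i
  refine Fin.cases ?_ (fun i => ?_) i
  · simpa [single_zero_right] using h (Pi.single 0 1)
  · simpa [single_succ_right] using h (Pi.single i.succ 1)

/-- Every linear functional is represented by the Lorentzian form. -/
lemma exists_repr (l : (Fin (n + 1) → ℝ) →L[ℝ] ℝ) : ∃ h, ∀ v, l v = lorentzB n h v := by
  refine ⟨Fin.cons (-l (Pi.single 0 1)) (fun i => l (Pi.single i.succ 1)), fun v => ?_⟩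
  have hv : v = ∑ i, v i • (Pi.single i (1 : ℝ) : Fin (n + 1) → ℝ) := by
    ext j; simp [Finset.sum_apply, Pi.single_apply]
  conv_lhs => rw [hv]
  simp only [lorentzB, Fin.sum_univ_succ, Fin.cons_zero,
    Fin.cons_succ]
  simp [mul_comm]

lemma self_of_zero (hx : x 0 = 0) : lorentzB n x x = ∑ i : Fin n, x i.succ ^ 2 := by
  simp [lorentzB, hx, sq]

variable {x} in
lemma eq_zero_of_self_nonpos (hx : x 0 = 0) (h : lorentzB n x x ≤ 0) : x = 0 := by
  rw [self_of_zero x hx] at h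
  have h' := (Finset.sum_eq_zero_iff_of_nonneg (fun i _ => sq_nonneg (x (Fin.succ i)))).1
    (le_antisymm h (Finset.sum_nonneg fun i _ => sq_nonneg _))
  funext i
  refine Fin.cases hx (fun i => ?_) i
  simpa using h' i (Finset.mem_univ _)

variable {x y} in
/-- Two orthogonal vectors none of which is spacelike are proportional. -/
lemma exists_eq_smul_of_nonpos (hx0 : x ≠ 0) (hx : lorentzB n x x ≤ 0)
    (hy : lorentzB n y y ≤ 0) (hxy : lorentzB n x y = 0) : ∃ k : ℝ, y = k • x := by
  have h0 : x 0 ≠ 0 := fun h => hx0 (eq_zero_of_self_nonpos h hx)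
  have hz : y 0 • x - x 0 • y = 0 := by
    apply eq_zero_of_self_nonpos
    · simp [mul_comm]
    · simp only [sub_left, sub_right, smul_left, smul_right, symm y x, hxy]
      nlinarith [mul_nonneg (sq_nonneg (y 0)) (neg_nonneg.2 hx),
        mul_nonneg (sq_nonneg (x 0)) (neg_nonneg.2 hy)]
  refine ⟨y 0 / x 0, ?_⟩
  rw [sub_eq_zero] at hz
  rw [div_eq_inv_mul, mul_smul, hz, smul_smul, inv_mul_cancel₀ h0, one_smul]

/-- The Euclidean quotient `e^⊥ / ℝe` for a null vector `e` with `e 0 = 1`, realised through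
the spatial coordinates of `u - u 0 • e`. -/
def screen (e : Fin (n + 1) → ℝ) : (Fin (n + 1) → ℝ) →ₗ[ℝ] EuclideanSpace ℝ (Fin n) where
  toFun u := WithLp.toLp 2 fun i => u i.succ - u 0 * e i.succ
  map_add' u v := by ext i; simp; ring
  map_smul' c u := by ext i; simp; ring

lemma screen_apply (e u : Fin (n + 1) → ℝ) (i : Fin n) :
    screen e u i = u i.succ - u 0 * e i.succ := rfl

variable {e u v : Fin (n + 1) → ℝ}

lemma eq_smul_of_screen_eq_zero (he0 : e 0 = 1) (h : screen e u = 0) : u = u 0 • e := by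
  funext i
  refine Fin.cases (by simp [he0]) (fun i => ?_) i
  have := congrArg (fun w : EuclideanSpace ℝ (Fin n) => w i) h
  simp only [screen_apply, PiLp.zero_apply, sub_eq_zero] at this
  simpa using this

lemma inner_screen (he0 : e 0 = 1) (he : lorentzB n e e = 0) (hu : lorentzB n e u = 0)
    (hv : lorentzB n e v = 0) : inner ℝ (screen e u) (screen e v) = lorentzB n u v := by
  have h : inner ℝ (screen e u) (screen e v)
      = lorentzB n (u - u 0 • e) (v - v 0 • e) := by
    simp [lorentzB, PiLp.inner_apply, screen_apply, he0, mul_comm]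
  rw [h]
  simp [sub_left, sub_right, smul_left, smul_right, he, hv, symm u e, hu]

lemma norm_screen_sq (he0 : e 0 = 1) (he : lorentzB n e e = 0) (hu : lorentzB n e u = 0) :
    ‖screen e u‖ ^ 2 = lorentzB n u u := by
  rw [← inner_screen he0 he hu hu, real_inner_self_eq_norm_sq]

end lorentzB

/-- The linear parts `A x` of a simply transitive group of Poincaré transformations, indexed by
the image `x` of the origin, together with their inverses `I x`. -/
structure IsOrbitCocycle {n : ℕ} (A I : (Fin (n + 1) → ℝ) →
    (Fin (n + 1) → ℝ) →L[ℝ] (Fin (n + 1) → ℝ)) : Prop where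
  map_add : ∀ x y, A (x + A x y) = A x * A y
  mul_inv : ∀ x, A x * I x = 1
  inv_mul : ∀ x, I x * A x = 1
  isom : ∀ x u v, lorentzB n (A x u) (A x v) = lorentzB n u v
  cont : Continuous A
  diff : DifferentiableAt ℝ I 0
  free : ∀ x y, A x y + x = y → x = 0

namespace IsOrbitCocycle

variable {n : ℕ} {A I : (Fin (n + 1) → ℝ) → (Fin (n + 1) → ℝ) →L[ℝ] (Fin (n + 1) → ℝ)}
  (hA : IsOrbitCocycle A I)
include hA

lemma apply_inv (x v) : A x (I x v) = v := by
  have := congrArg (fun T : _ →L[ℝ] _ => T v) (hA.mul_inv x); simpa using this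

lemma inv_apply (x v) : I x (A x v) = v := by
  have := congrArg (fun T : _ →L[ℝ] _ => T v) (hA.inv_mul x); simpa using this

lemma map_add_apply (x y v) : A (x + A x y) v = A x (A y v) := by rw [hA.map_add]; rfl

lemma map_zero_apply (v) : A 0 v = v := by
  have h := hA.map_add_apply 0 0 v
  rw [map_zero, add_zero] at h
  have := congrArg (I 0) h
  rwa [hA.inv_apply, hA.inv_apply, eq_comm] at this

lemma inv_zero_apply (v) : I 0 v = v := by
  have := hA.inv_apply 0 v
  rwa [hA.map_zero_apply] at this

lemma inv_add_apply (x y v) : I (x + A x y) v = I y (I x v) := by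
  rw [← hA.inv_apply (x + A x y) (I y (I x v)), hA.map_add_apply, hA.apply_inv, hA.apply_inv]

lemma isom_inv (x u v) : lorentzB n (I x u) (I x v) = lorentzB n u v := by
  rw [← hA.isom x, hA.apply_inv, hA.apply_inv]

lemma adjoint (x u v) : lorentzB n (A x u) v = lorentzB n u (I x v) := by
  rw [← hA.isom x u, hA.apply_inv]

lemma skew_fderiv (w u v) :
    lorentzB n (fderiv ℝ I 0 w u) v + lorentzB n u (fderiv ℝ I 0 w v) = 0 := by
  have hd : ∀ u, HasDerivAt (fun t : ℝ => I (t • w) u) (fderiv ℝ I 0 w u) 0 := by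
    intro u
    have h1 : HasDerivAt (fun t : ℝ => t • w) w 0 := by
      simpa using (hasDerivAt_id (0 : ℝ)).smul_const w
    have h0 : HasFDerivAt I (fderiv ℝ I 0) ((0 : ℝ) • w) := by
      rw [zero_smul]; exact hA.diff.hasFDerivAt
    have h2 := h0.comp_hasDerivAt (0 : ℝ) h1
    simpa using h2.clm_apply (hasDerivAt_const (0 : ℝ) u)
  have h3 := (((lorentzB.toCLM n).hasFDerivAt.comp_hasDerivAt (0 : ℝ) (hd u)).clm_apply (hd v))
  have h4 : (fun t : ℝ => (lorentzB.toCLM n ∘ fun t : ℝ => I (t • w) u) t (I (t • w) v))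
      = fun _ => lorentzB n u v := by
    funext t; simp [hA.isom_inv]
  rw [h4] at h3
  have := h3.unique (hasDerivAt_const _ _)
  simpa [hA.inv_zero_apply] using this

/-- A solution of the Euler equation `ṙ = I'(0)(r) r` starting at a stationary vector stays
constant. -/
lemma inv_smul_apply_of_stationary {h : Fin (n + 1) → ℝ} (hh : fderiv ℝ I 0 h h = 0) {T : ℝ}
    (hT : 0 ≤ T) : I (T • h) h = h := by
  set E := fderiv ℝ I 0 with hE
  set r : ℝ → Fin (n + 1) → ℝ := fun t => I (t • h) h with hr
  have hderiv : ∀ t, HasDerivAt r (E (r t) (r t)) t := by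
    intro t
    have h1 : HasDerivAt (fun s : ℝ => (s - t) • r t) (r t) t := by
      simpa using ((hasDerivAt_id t).sub_const t).smul_const (r t)
    have h2 : HasDerivAt (fun s : ℝ => I ((s - t) • r t)) (E (r t)) t :=
      hA.diff.hasFDerivAt.comp_hasDerivAt_of_eq t h1 (by simp)
    have h4 := h2.clm_apply (hasDerivAt_const t (r t))
    have h3 : r = fun s => I ((s - t) • r t) (r t) := by
      funext s
      simp only [hr]
      rw [← hA.inv_add_apply (t • h), map_smul, hA.apply_inv, ← add_smul]
      congr 2; ring_nf
    rw [map_zero, add_zero] at h4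
    rwa [← h3] at h4
  have hcont : Continuous r := continuous_iff_continuousAt.2 fun t => (hderiv t).continuousAt
  obtain ⟨C, hC⟩ := (isCompact_Icc (a := (0 : ℝ)) (b := T)).exists_bound_of_continuousOn
    hcont.continuousOn
  have key := eq_zero_of_abs_deriv_le_mul_abs_self_of_eq_zero_right (f := fun t => r t - h)
    (f' := fun t => E (r t) (r t)) (K := ‖E‖ * C + ‖E‖ * ‖h‖) (a := 0) (b := T)
    (hcont.sub continuous_const).continuousOn
    (fun t _ => ((hderiv t).sub_const h).hasDerivWithinAt)
    (by simp [hr, hA.inv_zero_apply]) ?_ T ⟨hT, le_rfl⟩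
  · exact sub_eq_zero.1 key
  · intro t ht
    have hsplit : E (r t) (r t) = E (r t - h) (r t) + E h (r t - h) := by
      simp only [map_sub, _root_.sub_apply, hh]; abel
    have h1 : ‖E (r t - h) (r t)‖ ≤ ‖E‖ * ‖r t - h‖ * C :=
      (E.le_opNorm₂ _ _).trans
        (mul_le_mul_of_nonneg_left (hC t ⟨ht.1, ht.2.le⟩) (by positivity))
    have h2 : ‖E h (r t - h)‖ ≤ ‖E‖ * ‖h‖ * ‖r t - h‖ := E.le_opNorm₂ _ _
    rw [hsplit]
    refine (norm_add_le _ _).trans ?_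
    linarith

end IsOrbitCocycle

/-- An orbit cocycle scaling a null vector `e` by a positive character `χ`, where `h` is the
Lorentzian gradient at the origin of `log χ`. -/
structure IsNullCocycle {n : ℕ} (A I : (Fin (n + 1) → ℝ) →
    (Fin (n + 1) → ℝ) →L[ℝ] (Fin (n + 1) → ℝ)) (e : Fin (n + 1) → ℝ)
    (χ : (Fin (n + 1) → ℝ) → ℝ) (h : Fin (n + 1) → ℝ) : Prop extends IsOrbitCocycle A I where
  e_zero : e 0 = 1
  e_null : lorentzB n e e = 0
  pos : ∀ x, 0 < χ x
  map_e : ∀ x, A x e = χ x • e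
  grad : ∀ x, HasFDerivAt (fun x => Real.log (χ x)) ((lorentzB.toCLM n h).comp (I x)) x

namespace IsNullCocycle

variable {n : ℕ} {A I : (Fin (n + 1) → ℝ) → (Fin (n + 1) → ℝ) →L[ℝ] (Fin (n + 1) → ℝ)}

/-- The character by which an orbit cocycle scales a null vector is differentiable. -/
lemma exists_of_map_e (hA : IsOrbitCocycle A I) {e : Fin (n + 1) → ℝ} (e_zero : e 0 = 1)
    (e_null : lorentzB n e e = 0) {χ : (Fin (n + 1) → ℝ) → ℝ} (pos : ∀ x, 0 < χ x)
    (map_e : ∀ x, A x e = χ x • e) : ∃ h, IsNullCocycle A I e χ h := by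
  have hinv : ∀ x, I x e = (χ x)⁻¹ • e := by
    intro x
    rw [← hA.inv_apply x ((χ x)⁻¹ • e), map_smul, map_e, smul_smul,
      inv_mul_cancel₀ (pos x).ne', one_smul]
  have hlog : (fun x => Real.log (χ x)) = fun x => -Real.log (I x e 0) := by
    funext x; simp [hinv, e_zero]
  have hmul : ∀ x y, χ (x + A x y) = χ x * χ y := by
    intro x y
    have := congrFun (hA.map_add_apply x y e) 0
    simpa [map_e, e_zero, mul_comm] using this
  have hd0 : DifferentiableAt ℝ (fun x => Real.log (χ x)) 0 := by
    rw [hlog]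
    refine (DifferentiableAt.log ?_ ?_).neg
    · have h1 : DifferentiableAt ℝ (fun x => I x e) 0 :=
        hA.diff.clm_apply (differentiableAt_const e)
      exact (differentiableAt_pi.1 h1) 0
    · simp [hA.inv_zero_apply, e_zero]
  obtain ⟨h, hh⟩ := lorentzB.exists_repr (fderiv ℝ (fun x => Real.log (χ x)) 0)
  refine ⟨h, ⟨hA, e_zero, e_null, pos, map_e, fun x => ?_⟩⟩
  have h1 : HasFDerivAt (fun z => Real.log (χ x) + Real.log (χ (I x (z - x))))
      ((fderiv ℝ (fun x => Real.log (χ x)) 0).comp (I x)) x := by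
    refine HasFDerivAt.const_add _ ?_
    refine HasFDerivAt.comp x (g := fun x => Real.log (χ x)) (f := fun z => I x (z - x)) ?_ ?_
    · simpa using hd0.hasFDerivAt
    · exact (I x).hasFDerivAt.comp x ((hasFDerivAt_id x).sub_const x)
  have h2 : (fun z => Real.log (χ z))
      = fun z => Real.log (χ x) + Real.log (χ (I x (z - x))) := by
    funext z
    rw [← Real.log_mul (pos _).ne' (pos _).ne', ← hmul, hA.apply_inv, add_sub_cancel]
  rw [h2]
  convert h1 using 1
  ext v
  simp [hh]

variable {e : Fin (n + 1) → ℝ} {χ : (Fin (n + 1) → ℝ) → ℝ} {h : Fin (n + 1) → ℝ}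
  (hN : IsNullCocycle A I e χ h)
include hN

lemma char_add (x y) : χ (x + A x y) = χ x * χ y := by
  have := congrFun (hN.map_add_apply x y e) 0
  simpa [hN.map_e, hN.e_zero, mul_comm] using this

lemma inv_e (x) : I x e = (χ x)⁻¹ • e := by
  rw [← hN.inv_apply x ((χ x)⁻¹ • e), map_smul, hN.map_e, smul_smul,
    inv_mul_cancel₀ (hN.pos x).ne', one_smul]

lemma char_smul_e (t : ℝ) : χ (t • e) = 1 := by
  by_contra hne
  have h1 : 1 - χ (t • e) ≠ 0 := sub_ne_zero.2 (Ne.symm hne)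
  have h0 : t • e = 0 := by
    refine hN.free _ ((t / (1 - χ (t • e))) • e) ?_
    rw [map_smul, hN.map_e, smul_smul, ← add_smul]
    congr 1; field_simp; ring
  have := hN.map_e 0
  rw [hN.map_zero_apply] at this
  have := congrFun this 0
  rw [h0] at hne
  simp [hN.e_zero] at this
  exact hne this.symm

lemma char_add_smul_e (x) (t : ℝ) : χ (x + t • e) = χ x := by
  have := hN.char_add x ((t / χ x) • e)
  rwa [map_smul, hN.map_e, smul_smul, div_mul_cancel₀ _ (hN.pos x).ne', hN.char_smul_e,
    mul_one] at this

lemma hasDerivAt_log_char (x v) (t : ℝ) :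
    HasDerivAt (fun t : ℝ => Real.log (χ (x + t • v))) (lorentzB n (A (x + t • v) h) v) t := by
  have h1 : HasDerivAt (fun t : ℝ => x + t • v) v t := by
    simpa using ((hasDerivAt_id t).smul_const v).const_add x
  have := (hN.grad (x + t • v)).comp_hasDerivAt t h1
  simpa [Function.comp_def, hN.adjoint] using this

lemma apply_add_smul_e (x) (t : ℝ) : A (x + t • e) h = A x h := by
  apply lorentzB.ext_right
  intro v
  have h1 := hN.hasDerivAt_log_char (x + t • e) v 0
  have h2 := hN.hasDerivAt_log_char x v 0
  have h3 : (fun s : ℝ => Real.log (χ (x + t • e + s • v)))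
      = fun s : ℝ => Real.log (χ (x + s • v)) := by
    funext s; rw [add_right_comm, hN.char_add_smul_e]
  rw [h3] at h1
  simpa using h1.unique h2

lemma e_orthogonal_grad : lorentzB n e h = 0 := by
  have h1 := hN.hasDerivAt_log_char 0 e 0
  have h3 : (fun s : ℝ => Real.log (χ (0 + s • e))) = fun _ => 0 := by
    funext s; rw [zero_add, hN.char_smul_e, Real.log_one]
  rw [h3] at h1
  have := h1.unique (hasDerivAt_const _ _)
  rw [lorentzB.symm]
  simpa [hN.map_zero_apply] using this

lemma e_orthogonal (x u) : lorentzB n e (A x u) = (χ x)⁻¹ * lorentzB n e u := by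
  rw [lorentzB.symm, hN.adjoint, hN.inv_e, lorentzB.smul_right, lorentzB.symm]

lemma e_orthogonal_apply_grad (x) : lorentzB n e (A x h) = 0 := by
  rw [hN.e_orthogonal, hN.e_orthogonal_grad, mul_zero]

/-- The eikonal equation: the gradient of `log χ` has constant norm, hence is stationary along
itself. -/
lemma stationary : fderiv ℝ I 0 h h = 0 := by
  have hE : HasFDerivAt (fun x => (lorentzB.toCLM n h).comp (I x))
      ((ContinuousLinearMap.compL ℝ _ _ _ (lorentzB.toCLM n h)).comp (fderiv ℝ I 0)) 0 :=
    HasFDerivAt.comp (0 : Fin (n + 1) → ℝ)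
      (g := ContinuousLinearMap.compL ℝ (Fin (n + 1) → ℝ) _ ℝ (lorentzB.toCLM n h))
      (ContinuousLinearMap.hasFDerivAt _) hN.diff.hasFDerivAt
  have hs := second_derivative_symmetric hN.grad hE
  apply lorentzB.ext_right
  intro z
  have h1 := hs h z
  simp only [ContinuousLinearMap.comp_apply, ContinuousLinearMap.compL_apply,
    lorentzB.toCLM_apply] at h1
  have h2 := hN.skew_fderiv h h z
  have h3 := hN.skew_fderiv z h h
  rw [lorentzB.symm] at h3
  rw [lorentzB.zero_left]
  linarith

lemma fix_grad {t : ℝ} (ht : 0 ≤ t) : A (t • h) h = h := by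
  have := congrArg (A (t • h)) (hN.inv_smul_apply_of_stationary hN.stationary ht)
  rwa [hN.apply_inv, eq_comm] at this

lemma log_char_smul_grad {t : ℝ} (ht : 0 ≤ t) :
    χ (t • h) = Real.exp (t * lorentzB n h h) := by
  have h3 : χ 0 = 1 := by simpa using hN.char_smul_e 0
  have h0 : ∀ s, HasDerivAt (fun s : ℝ => Real.log (χ (s • h)) - s * lorentzB n h h)
      (lorentzB n (A (s • h) h) h - lorentzB n h h) s := by
    intro s
    have := (hN.hasDerivAt_log_char 0 h s).fun_sub
      ((hasDerivAt_id s).mul_const (lorentzB n h h))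
    simpa only [zero_add, id, one_mul] using this
  have h2 := constant_of_has_deriv_right_zero (a := 0) (b := t)
    (f := fun s : ℝ => Real.log (χ (s • h)) - s * lorentzB n h h)
    (fun s _ => (h0 s).continuousAt.continuousWithinAt)
    (fun s hs => by simpa [hN.fix_grad hs.1] using (h0 s).hasDerivWithinAt) t ⟨ht, le_rfl⟩
  simp only [zero_smul, h3, Real.log_one, zero_mul, sub_zero] at h2
  rw [← sub_eq_zero.1 h2, Real.exp_log (hN.pos _)]

end IsNullCocycle

lemma nonpos_of_forall_nonneg_mul_le {d C : ℝ} (h : ∀ t, 0 ≤ t → t * d ≤ C) : d ≤ 0 := by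
  by_contra! hd
  have hC : 0 ≤ C := by simpa using h 0 le_rfl
  have := h ((C + 1) / d) (by positivity)
  rw [div_mul_cancel₀ _ hd.ne'] at this
  linarith

namespace IsNullCocycle

open lorentzB

variable {n : ℕ} {A I : (Fin (n + 1) → ℝ) → (Fin (n + 1) → ℝ) →L[ℝ] (Fin (n + 1) → ℝ)}
  {e : Fin (n + 1) → ℝ} {χ : (Fin (n + 1) → ℝ) → ℝ} {h : Fin (n + 1) → ℝ}
  (hN : IsNullCocycle A I e χ h)
include hN

lemma norm_screen_apply_grad (x) : ‖screen e (A x h)‖ = ‖screen e h‖ := by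
  rw [← sq_eq_sq₀ (norm_nonneg _) (norm_nonneg _),
    norm_screen_sq hN.e_zero hN.e_null (hN.e_orthogonal_apply_grad x),
    norm_screen_sq hN.e_zero hN.e_null hN.e_orthogonal_grad, hN.isom]

/-- `log χ` is Lipschitz along the degenerate hyperplanes parallel to `e^⊥`. -/
lemma log_char_sub_le {a b : Fin (n + 1) → ℝ} (hab : lorentzB n e (b - a) = 0) :
    Real.log (χ b) - Real.log (χ a) ≤ ‖screen e h‖ * ‖screen e (b - a)‖ := by
  have hd := hN.hasDerivAt_log_char a (b - a)
  obtain ⟨c, -, hc⟩ := exists_hasDerivAt_eq_slope _ _ (zero_lt_one (α := ℝ))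
    (fun t _ => (hd t).continuousAt.continuousWithinAt) (fun t _ => hd t)
  simp only [one_smul, add_sub_cancel, zero_smul, add_zero, sub_zero, div_one] at hc
  rw [← hc, ← inner_screen hN.e_zero hN.e_null (hN.e_orthogonal_apply_grad _) hab,
    ← hN.norm_screen_apply_grad (a + c • (b - a))]
  exact real_inner_le_norm _ _

lemma log_char_add_grad (x) {t : ℝ} (ht : 0 ≤ t) :
    Real.log (χ (x + t • A x h)) = Real.log (χ x) + t * lorentzB n h h := by
  rw [← map_smul, hN.char_add, Real.log_mul (hN.pos _).ne' (hN.pos _).ne',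
    hN.log_char_smul_grad ht, Real.log_exp]

lemma log_char_sub_grad (x) {t : ℝ} (ht : 0 ≤ t) :
    Real.log (χ (x - t • A x h)) = Real.log (χ x) - t * lorentzB n h h := by
  have h1 : χ (t • h) * χ (-(t • h)) = 1 := by
    rw [← hN.char_add, map_neg, map_smul, hN.fix_grad ht, add_neg_cancel]
    simpa using hN.char_smul_e 0
  have h2 : x - t • A x h = x + A x (-(t • h)) := by
    rw [map_neg, map_smul, sub_eq_add_neg]
  rw [h2, hN.char_add, eq_inv_of_mul_eq_one_right h1, Real.log_mul (hN.pos _).ne'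
    (inv_pos.2 (hN.pos _)).ne', Real.log_inv, hN.log_char_smul_grad ht, Real.log_exp,
    sub_eq_add_neg]

/-- A global solution of the eikonal equation on Euclidean space has constant gradient. -/
lemma screen_apply_grad_eq (hm : 0 < lorentzB n h h) {x y : Fin (n + 1) → ℝ}
    (hxy : lorentzB n e (y - x) = 0) : screen e (A x h) = screen e (A y h) := by
  set p := screen e (A x h) with hp
  set q := screen e (A y h) with hq
  set k := ‖screen e h‖ with hk
  have hk2 : k ^ 2 = lorentzB n h h := norm_screen_sq hN.e_zero hN.e_null hN.e_orthogonal_grad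
  have hk0 : 0 < k := by
    refine lt_of_le_of_ne (norm_nonneg _) fun h0 => ?_
    rw [← hk2, ← h0] at hm
    simp at hm
  have hpk : ‖p‖ = k := hN.norm_screen_apply_grad x
  have hqk : ‖q‖ = k := hN.norm_screen_apply_grad y
  have key : 2 * k ^ 2 - k * ‖p + q‖ ≤ 0 := by
    refine nonpos_of_forall_nonneg_mul_le
      (C := k * ‖screen e (y - x)‖ - Real.log (χ y) + Real.log (χ x)) fun t ht => ?_
    have h1 : y + t • A y h - (x - t • A x h) = (y - x) + t • (A x h + A y h) := by
      rw [smul_add]; abel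
    have h2 := hN.log_char_sub_le (a := x - t • A x h) (b := y + t • A y h) (by
      rw [h1, add_right, smul_right, add_right, hN.e_orthogonal_apply_grad,
        hN.e_orthogonal_apply_grad, hxy]
      ring)
    have h3 : ‖screen e (y + t • A y h - (x - t • A x h))‖
        ≤ ‖screen e (y - x)‖ + t * ‖p + q‖ := by
      rw [h1, map_add, map_smul, map_add]
      refine (norm_add_le _ _).trans ?_
      rw [norm_smul, Real.norm_of_nonneg ht]
    rw [hN.log_char_add_grad y ht, hN.log_char_sub_grad x ht, ← hk2] at h2
    have h4 := mul_le_mul_of_nonneg_left h3 hk0.le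
    linarith
  have hS : 2 * k ≤ ‖p + q‖ := by nlinarith
  have hpar := parallelogram_law_with_norm ℝ p q
  rw [hpk, hqk] at hpar
  have : ‖p - q‖ * ‖p - q‖ ≤ 0 := by nlinarith [norm_nonneg (p + q)]
  exact sub_eq_zero.1 (norm_eq_zero.1 (mul_self_eq_zero.1 (le_antisymm this (by positivity))))

lemma exists_apply_grad_eq (hm : 0 < lorentzB n h h) {u : Fin (n + 1) → ℝ}
    (hu : lorentzB n e u = 0) : ∃ b : ℝ, A u h = h + b • e := by
  have h1 := hN.screen_apply_grad_eq hm (x := 0) (y := u) (by rwa [sub_zero])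
  rw [hN.map_zero_apply] at h1
  have h2 : screen e (A u h - h) = 0 := by rw [map_sub, h1, sub_self]
  exact ⟨_, by rw [← eq_smul_of_screen_eq_zero hN.e_zero h2]; abel⟩

lemma apply_add_smul_grad (hm : 0 < lorentzB n h h) {u : Fin (n + 1) → ℝ}
    (hu : lorentzB n e u = 0) {t : ℝ} (ht : 0 ≤ t) : A (u + t • h) h = A u h := by
  obtain ⟨b, hb⟩ := hN.exists_apply_grad_eq hm hu
  have h1 := hN.map_add_apply u (t • h) h
  rwa [map_smul, hb, smul_add, smul_smul, ← add_assoc, hN.apply_add_smul_e, hN.fix_grad ht,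
    hb, ← hb] at h1

lemma apply_grad_of_orthogonal (hm : 0 < lorentzB n h h) {u : Fin (n + 1) → ℝ}
    (hu : lorentzB n e u = 0) : A u h = h := by
  obtain ⟨b, hb⟩ := hN.exists_apply_grad_eq hm hu
  have hcont : Continuous fun w => A w h 0 :=
    (continuous_apply 0).comp (hN.cont.clm_apply continuous_const)
  obtain ⟨C, hC⟩ := (isCompact_closedBall (0 : Fin (n + 1) → ℝ)
    ‖screen e u‖).exists_bound_of_continuousOn hcont.continuousOn
  have key : |b| * lorentzB n h h ≤ 0 := by
    refine nonpos_of_forall_nonneg_mul_le (C := C + |h 0|) fun t ht => ?_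
    set w := A (t • h) u with hw
    have hwe : lorentzB n e w = 0 := by rw [hN.e_orthogonal, hu, mul_zero]
    have h1 : A w h = h + (b * χ (t • h)) • e := by
      rw [← hN.apply_add_smul_grad hm hwe ht, add_comm w (t • h), hN.map_add_apply, hb, _root_.map_add,
        map_smul, hN.map_e, hN.fix_grad ht, smul_smul]
    have h2 : w + (-w 0) • e ∈ Metric.closedBall (0 : Fin (n + 1) → ℝ) ‖screen e u‖ := by
      have hsc : ‖screen e w‖ = ‖screen e u‖ := by
        rw [← sq_eq_sq₀ (norm_nonneg _) (norm_nonneg _),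
          norm_screen_sq hN.e_zero hN.e_null hwe, norm_screen_sq hN.e_zero hN.e_null hu, hN.isom]
      rw [mem_closedBall_zero_iff, pi_norm_le_iff_of_nonneg (norm_nonneg _)]
      intro i
      refine Fin.cases (by simp [hN.e_zero]) (fun i => ?_) i
      rw [← hsc]
      have := PiLp.norm_apply_le (screen e w) i
      rw [screen_apply] at this
      simpa [← sub_eq_add_neg] using this
    have h3 := hC _ h2
    simp only [hN.apply_add_smul_e, h1, hN.log_char_smul_grad ht, Pi.add_apply, Pi.smul_apply,
      smul_eq_mul, hN.e_zero, mul_one, Real.norm_eq_abs] at h3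
    have h4 : |b| * Real.exp (t * lorentzB n h h) ≤ C + |h 0| := by
      rw [← abs_of_pos (Real.exp_pos (t * lorentzB n h h)), ← abs_mul]
      have := abs_sub_abs_le_abs_sub (b * Real.exp (t * lorentzB n h h)) (-h 0)
      rw [abs_neg, sub_neg_eq_add, add_comm (b * _)] at this
      linarith
    have h5 := Real.add_one_le_exp (t * lorentzB n h h)
    nlinarith [abs_nonneg b]
  have hb0 : b = 0 := by
    rw [← abs_nonpos_iff]; exact nonpos_of_mul_nonpos_left key hm
  rw [hb, hb0, zero_smul, add_zero]

lemma apply_grad_congr (hm : 0 < lorentzB n h h) {x y : Fin (n + 1) → ℝ}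
    (hxy : lorentzB n e (y - x) = 0) : A y h = A x h := by
  have h1 := hN.map_add_apply x (I x (y - x)) h
  have h2 : lorentzB n e (I x (y - x)) = 0 := by
    have := hN.e_orthogonal x (I x (y - x))
    rw [hN.apply_inv, hxy, eq_comm, mul_eq_zero] at this
    exact this.resolve_left (inv_pos.2 (hN.pos x)).ne'
  rwa [hN.apply_inv, add_sub_cancel, hN.apply_grad_of_orthogonal hm h2] at h1

/-- If the gradient of `log χ` is spacelike then it is a fixed vector. -/
lemma apply_grad (hm : 0 < lorentzB n h h) (x) : A x h = h := by
  set m := lorentzB n h h with hm'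
  set y : ℝ → Fin (n + 1) → ℝ := fun t =>
    (-((Real.exp (t * m))⁻¹ * lorentzB n e x)) • Pi.single 0 1 with hy
  have h1 : ∀ t, 0 ≤ t → A (y t) h = A (t • h) (A x h) := by
    intro t ht
    rw [← hN.map_add_apply]
    apply hN.apply_grad_congr hm
    rw [sub_right, add_right, smul_right, smul_right, hN.e_orthogonal_grad, hN.e_orthogonal,
      hN.log_char_smul_grad ht, single_zero_right, hN.e_zero]
    ring
  have hylim : Tendsto (fun t => A (y t) h) atTop (𝓝 h) := by
    have h2 : Tendsto y atTop (𝓝 0) := by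
      have h3 : Tendsto (fun t : ℝ => (Real.exp (t * m))⁻¹) atTop (𝓝 0) :=
        tendsto_inv_atTop_zero.comp
          (Real.tendsto_exp_atTop.comp (tendsto_id.atTop_mul_const hm))
      simpa [hy] using ((h3.mul_const (lorentzB n e x)).neg).smul_const
        (Pi.single 0 1 : Fin (n + 1) → ℝ)
    have h4 : Tendsto (fun w => A w h) (𝓝 0) (𝓝 (A 0 h)) :=
      (hN.cont.clm_apply continuous_const).tendsto 0
    rw [hN.map_zero_apply] at h4
    exact h4.comp h2
  have h5 : lorentzB n (A x h) h = m := by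
    have h6 : Tendsto (fun t => lorentzB n (A (y t) h) h) atTop (𝓝 m) :=
      (((toCLM n).continuous.clm_apply continuous_const).tendsto h).comp hylim
    refine tendsto_nhds_unique (tendsto_const_nhds.congr' ?_) h6
    filter_upwards [eventually_ge_atTop 0] with t ht
    have h7 := hN.isom (t • h) (A x h) h
    rw [hN.fix_grad ht] at h7
    rw [h1 t ht, h7]
  have h7 : screen e (A x h - h) = 0 := by
    have h8 : lorentzB n e (A x h - h) = 0 := by
      rw [sub_right, hN.e_orthogonal_apply_grad, hN.e_orthogonal_grad, sub_zero]
    have h9 := norm_screen_sq hN.e_zero hN.e_null h8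
    rw [sub_left, sub_right, sub_right, hN.isom, symm h (A x h), h5, ← hm'] at h9
    have : ‖screen e (A x h - h)‖ ^ 2 = 0 := by rw [h9]; ring
    simpa using this
  have h10 := eq_smul_of_screen_eq_zero hN.e_zero h7
  set s := (A x h - h) 0 with hs
  have h11 : s = 0 := by
    have h12 : Tendsto (fun t => A (y t) h 0 - h 0) atTop (𝓝 0) := by
      simpa using (((continuous_apply 0).tendsto h).comp hylim).sub_const (h 0)
    rw [← abs_nonpos_iff]
    refine ge_of_tendsto (by simpa using h12.abs) ?_
    filter_upwards [eventually_ge_atTop 0] with t ht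
    rw [h1 t ht, show A x h = h + s • e by rw [← h10]; abel, _root_.map_add, map_smul,
      hN.map_e, hN.fix_grad ht, hN.log_char_smul_grad ht]
    simp only [Pi.add_apply, Pi.smul_apply, smul_eq_mul, hN.e_zero, mul_one, add_sub_cancel_left,
      abs_mul, abs_of_pos (Real.exp_pos _)]
    exact le_mul_of_one_le_right (abs_nonneg _) (Real.one_le_exp (by positivity))
  rw [h11, zero_smul] at h10
  exact sub_eq_zero.1 h10

/-- If the gradient of `log χ` is a multiple of `e` then it vanishes: otherwise `χ` would blow
up in finite time. -/
lemma grad_eq_zero {c : ℝ} (hc : h = c • e) : c = 0 := by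
  by_contra hc0
  set v : Fin (n + 1) → ℝ := -Pi.single 0 1 with hv
  have hev : lorentzB n e v = 1 := by
    rw [hv, ← neg_one_smul ℝ, smul_right, single_zero_right, hN.e_zero]; ring
  have hd : ∀ t : ℝ, HasDerivAt (fun t : ℝ => Real.exp (-Real.log (χ (0 + t • v))) + t * c) 0 t := by
    intro t
    have h1 := (hN.hasDerivAt_log_char 0 v t).fun_neg.exp.fun_add
      ((hasDerivAt_id t).mul_const c)
    have h2 : A (0 + t • v) h = (c * χ (0 + t • v)) • e := by
      conv_lhs => rw [hc, map_smul, hN.map_e, smul_smul]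
    have h3 : Real.exp (-Real.log (χ (0 + t • v))) * -lorentzB n (A (0 + t • v) h) v
        + 1 * c = 0 := by
      rw [h2, smul_left, hev, Real.exp_neg, Real.exp_log (hN.pos _)]
      have := (hN.pos (0 + t • v)).ne'
      field_simp
      ring
    rw [h3] at h1
    exact h1
  have h2 := is_const_of_deriv_eq_zero (fun t => (hd t).differentiableAt)
    (fun t => (hd t).deriv) (1 / c) 0
  have h3 : χ 0 = 1 := by simpa using hN.char_smul_e 0
  rw [div_mul_cancel₀ _ hc0] at h2
  simp only [zero_smul, add_zero, h3, Real.log_one, neg_zero, Real.exp_zero, zero_mul] at h2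
  have := Real.exp_pos (-Real.log (χ (0 + (1 / c) • v)))
  linarith

theorem exists_fixed : ∃ v ≠ 0, ∀ x, A x v = v := by
  have hsq := norm_screen_sq hN.e_zero hN.e_null hN.e_orthogonal_grad
  have hm : 0 ≤ lorentzB n h h := hsq ▸ sq_nonneg _
  rcases hm.lt_or_eq with hm | hm
  · exact ⟨h, fun h0 => by simp [h0, zero_left] at hm, hN.apply_grad hm⟩
  · have h1 : screen e h = 0 := by
      rw [← hm] at hsq; simpa using hsq
    have h2 := eq_smul_of_screen_eq_zero hN.e_zero h1
    have h3 := hN.grad_eq_zero h2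
    rw [h3, zero_smul] at h2
    refine ⟨e, fun h0 => by simpa [h0] using hN.e_zero, fun x => ?_⟩
    have hg : ∀ x, HasFDerivAt (fun x => Real.log (χ x)) (0 : (Fin (n + 1) → ℝ) →L[ℝ] ℝ) x := by
      intro x; simpa [h2] using hN.grad x
    have h4 := is_const_of_fderiv_eq_zero (fun x => (hg x).differentiableAt)
      (fun x => (hg x).fderiv) x 0
    have h5 : χ 0 = 1 := by simpa using hN.char_smul_e 0
    rw [h5, Real.log_one] at h4
    rw [hN.map_e, Real.eq_one_of_pos_of_log_eq_zero (hN.pos x) h4, one_smul]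

end IsNullCocycle

section Smoothness

open MeasureTheory Metric

variable {E : Type*} [NormedAddCommGroup E] [NormedSpace ℝ E] [FiniteDimensional ℝ E]
  [MeasurableSpace E] [BorelSpace E] {μ : Measure E} [IsLocallyFiniteMeasure μ]
  [μ.IsOpenPosMeasure] {A I : E → E →L[ℝ] E}

lemma exists_isUnit_integral_bump (hA : Continuous A) (hA0 : A 0 = 1) :
    ∃ f : ContDiffBump (0 : E), IsUnit (∫ z, f.normed μ z • A z ∂μ) := by
  obtain ⟨δ, hδ, h⟩ := Metric.continuousAt_iff.1 hA.continuousAt (1 / 2) one_half_pos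
  let f : ContDiffBump (0 : E) := ⟨δ / 2, δ, by positivity, by linarith⟩
  refine ⟨f, ?_⟩
  have hcs : HasCompactSupport (f.normed μ) := f.hasCompactSupport_normed
  have hi : Integrable (fun z => f.normed μ z • A z) μ :=
    (f.continuous_normed.smul hA).integrable_of_hasCompactSupport hcs.smul_right
  have hi1 : Integrable (fun z => f.normed μ z • (1 : E →L[ℝ] E)) μ :=
    f.integrable_normed.smul_const _
  have h1 : ‖∫ z, f.normed μ z • ((1 : E →L[ℝ] E) - A z) ∂μ‖ ≤ ∫ z, f.normed μ z * (1 / 2) ∂μ := by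
    refine norm_integral_le_of_norm_le (f.integrable_normed.mul_const _) (.of_forall fun z => ?_)
    rw [norm_smul, Real.norm_of_nonneg (f.nonneg_normed z)]
    by_cases hz : z ∈ ball (0 : E) δ
    · refine mul_le_mul_of_nonneg_left ?_ (f.nonneg_normed z)
      have := h hz
      rw [hA0, dist_comm, dist_eq_norm] at this
      exact this.le
    · have : f.normed μ z = 0 := by
        rw [← Function.notMem_support, f.support_normed_eq]; exact hz
      simp [this]
  rw [integral_mul_const, f.integral_normed] at h1
  have h2 : ∫ z, f.normed μ z • ((1 : E →L[ℝ] E) - A z) ∂μ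
      = 1 - ∫ z, f.normed μ z • A z ∂μ := by
    simp_rw [smul_sub]
    rw [integral_sub hi1 hi, integral_smul_const, f.integral_normed, one_smul]
  rw [h2] at h1
  have := isUnit_one_sub_of_norm_lt_one (h1.trans_lt (by norm_num))
  rwa [sub_sub_cancel] at this

lemma differentiableAt_integral_bump (hA : Continuous A) (hI : Continuous I)
    (hmap : ∀ x y, A (x + A x y) = A x * A y) (hAI : ∀ x, A x * I x = 1)
    (f : ContDiffBump (0 : E)) :
    DifferentiableAt ℝ (fun p => ∫ z, f.normed μ (z + A z p) • A z ∂μ) 0 := by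
  set φ := f.normed μ with hφ
  have hsm : ContDiff ℝ 1 φ := f.contDiff_normed (n := 1)
  set K : Set E := (fun q : E × E => q.1 + A q.1 (-I q.2 q.2)) ''
    (closedBall 0 f.rOut ×ˢ closedBall 0 1) with hK
  have hKc : IsCompact K := by
    refine ((isCompact_closedBall _ _).prod (isCompact_closedBall _ _)).image ?_
    exact continuous_fst.add ((hA.comp continuous_fst).clm_apply
      ((hI.comp continuous_snd).clm_apply continuous_snd).neg)
  have hout : ∀ p ∈ ball (0 : E) 1, ∀ z ∉ K, z + A z p ∉ tsupport φ := by
    intro p hp z hz hmem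
    rw [hφ, f.tsupport_normed_eq] at hmem
    refine hz ⟨(z + A z p, p), ⟨hmem, ball_subset_closedBall hp⟩, ?_⟩
    have h1 := congrArg (fun T : E →L[ℝ] E => T p) (hAI p)
    simp only [mul_apply_eq_comp, one_apply_eq_self] at h1
    simp [hmap, h1]
  set F' : E → E → E →L[ℝ] E →L[ℝ] E := fun p z =>
    ((fderiv ℝ φ (z + A z p)).comp (A z)).smulRight (A z) with hF'
  have hF'c : Continuous fun q : E × E => F' q.1 q.2 := by
    have hA2 : Continuous fun q : E × E => A q.2 := hA.comp continuous_snd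
    have h1 : Continuous fun q : E × E => fderiv ℝ φ (q.2 + A q.2 q.1) :=
      (hsm.continuous_fderiv one_ne_zero).comp
        (continuous_snd.add (hA2.clm_apply continuous_fst))
    exact ((ContinuousLinearMap.smulRightL ℝ E (E →L[ℝ] E)).continuous.comp
      (h1.clm_comp hA2)).clm_apply hA2
  obtain ⟨C, hC⟩ := ((isCompact_closedBall (0 : E) 1).prod hKc).exists_bound_of_continuousOn
    (f := fun q : E × E => F' q.1 q.2) hF'c.continuousOn
  have hFc : ∀ p, Continuous fun z => φ (z + A z p) • A z := fun p =>
    (hsm.continuous.comp (continuous_id.add (hA.clm_apply continuous_const))).smul hA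
  refine (hasFDerivAt_integral_of_dominated_of_fderiv_le (F' := F')
    (bound := K.indicator fun _ => C) (ball_mem_nhds (0 : E) one_pos)
    (.of_forall fun p => (hFc p).aestronglyMeasurable) ?_
    (hF'c.comp (Continuous.prodMk_right 0)).aestronglyMeasurable
    (.of_forall fun z p hp => ?_) ?_ (.of_forall fun z p hp => ?_)).differentiableAt
  · refine (hFc 0).integrable_of_hasCompactSupport (HasCompactSupport.intro hKc fun z hz => ?_)
    rw [image_eq_zero_of_notMem_tsupport (hout 0 (mem_ball_self one_pos) z hz), zero_smul]
  · by_cases hz : z ∈ K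
    · rw [Set.indicator_of_mem hz]
      exact hC (p, z) ⟨ball_subset_closedBall hp, hz⟩
    · have : fderiv ℝ φ (z + A z p) = 0 :=
        image_eq_zero_of_notMem_tsupport fun h => hout p hp z hz (tsupport_fderiv_subset ℝ h)
      simp [hF', this, Set.indicator_of_notMem hz]
  · exact (integrable_indicator_iff hKc.measurableSet).2
      (integrableOn_const hKc.measure_lt_top.ne)
  · exact (((hsm.differentiable one_ne_zero _).hasFDerivAt).comp p
      ((A z).hasFDerivAt.const_add z)).smul_const (A z)

/-- A continuous crossed homomorphism is differentiable at the origin if right translations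
`z ↦ z + A z p` preserve a reference measure. -/
lemma differentiableAt_of_measurePreserving (hA : Continuous A) (hI : Continuous I)
    (hmap : ∀ x y, A (x + A x y) = A x * A y) (hAI : ∀ x, A x * I x = 1)
    (hμ : ∀ p, Measure.map (fun z => z + A z p) μ = μ) : DifferentiableAt ℝ I 0 := by
  have hA0 : A 0 = 1 := by
    have h1 := hmap 0 0
    rw [map_zero, add_zero] at h1
    rw [← mul_one (A 0), ← hAI 0, ← mul_assoc, ← h1]
  obtain ⟨f, hM⟩ := exists_isUnit_integral_bump (μ := μ) hA hA0
  have hd := differentiableAt_integral_bump (μ := μ) hA hI hmap hAI f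
  have key : ∀ p, ∫ z, f.normed μ (z + A z p) • A z ∂μ
      = (∫ z, f.normed μ z • A z ∂μ) * I p := by
    intro p
    have hc : Continuous fun z => z + A z p :=
      continuous_id.add (hA.clm_apply continuous_const)
    have hcw : Continuous fun w => f.normed μ w • (A w * I p) :=
      f.continuous_normed.smul (hA.mul continuous_const)
    have hi : Integrable (fun z => f.normed μ z • A z) μ :=
      (f.continuous_normed.smul hA).integrable_of_hasCompactSupport
        f.hasCompactSupport_normed.smul_right
    have h1 := integral_map (μ := μ) hc.aemeasurable
      (f := fun w => f.normed μ w • (A w * I p)) hcw.aestronglyMeasurable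
    rw [hμ p] at h1
    have h2 := ((ContinuousLinearMap.mul ℝ (E →L[ℝ] E)).flip (I p)).integral_comp_comm hi
    simp only [ContinuousLinearMap.flip_apply, ContinuousLinearMap.mul_apply'] at h2
    rw [← h2]
    simp_rw [smul_mul_assoc]
    rw [h1]
    simp_rw [hmap, mul_assoc, hAI, mul_one]
  simp_rw [key] at hd
  obtain ⟨M, hM'⟩ := hM
  have h3 : I = fun p => (↑M⁻¹ : E →L[ℝ] E) * ((∫ z, f.normed μ z • A z ∂μ) * I p) := by
    funext p
    rw [← hM', Units.inv_mul_cancel_left]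
  rw [h3]
  exact hd.const_mul _

end Smoothness

namespace Poincare

open MeasureTheory

variable {n : ℕ}

lemma continuous_matOf : Continuous (matOf : LorentzO n → Matrix _ _ ℝ) :=
  Units.continuous_val.comp continuous_subtype_val

lemma isInducing_lin_tr : Topology.IsInducing fun g : Poincare n => (g.lin, g.tr) := ⟨rfl⟩

lemma continuous_lin : Continuous (lin : Poincare n → _) :=
  continuous_fst.comp isInducing_lin_tr.continuous

lemma continuous_tr : Continuous (tr : Poincare n → _) :=
  continuous_snd.comp isInducing_lin_tr.continuous

lemma continuous_mat : Continuous (mat : Poincare n → _) := continuous_matOf.comp continuous_lin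

instance : IsTopologicalGroup (Poincare n) where
  continuous_mul := isInducing_lin_tr.continuous_iff.2 <|
    ((continuous_lin.comp continuous_fst).mul (continuous_lin.comp continuous_snd)).prodMk
      ((continuous_tr.comp continuous_fst).add ((continuous_mat.comp continuous_fst).matrix_mulVec
        (continuous_tr.comp continuous_snd)))
  continuous_inv := isInducing_lin_tr.continuous_iff.2 <|
    continuous_lin.inv.prodMk
      ((continuous_matOf.comp continuous_lin.inv).matrix_mulVec continuous_tr).neg

instance : ContinuousSMul (Poincare n) (Fin (n + 1) → ℝ) where
  continuous_smul := ((continuous_mat.comp continuous_fst).matrix_mulVec continuous_snd).add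
    (continuous_tr.comp continuous_fst)

lemma continuous_lorentzB : Continuous fun p : (Fin (n + 1) → ℝ) × (Fin (n + 1) → ℝ) =>
    lorentzB n p.1 p.2 := by
  unfold lorentzB; fun_prop

lemma isClosed_lorentzO : IsClosed (LorentzO n : Set (GL (Fin (n + 1)) ℝ)) := by
  have : (LorentzO n : Set (GL (Fin (n + 1)) ℝ)) = ⋂ x, ⋂ y,
      {A : GL (Fin (n + 1)) ℝ | lorentzB n ((A : Matrix (Fin (n + 1)) (Fin (n + 1)) ℝ).mulVec x)
        ((A : Matrix (Fin (n + 1)) (Fin (n + 1)) ℝ).mulVec y) = lorentzB n x y} := by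
    ext A; simp [LorentzO]
  rw [this]
  refine isClosed_iInter fun x => isClosed_iInter fun y => isClosed_eq ?_ continuous_const
  exact continuous_lorentzB.comp
    ((Units.continuous_val.matrix_mulVec continuous_const).prodMk
      (Units.continuous_val.matrix_mulVec continuous_const))

lemma bijective_lin_tr : Function.Bijective fun g : Poincare n => (g.lin, g.tr) :=
  ⟨fun _ _ h => ext' (congrArg Prod.fst h) (congrArg Prod.snd h), fun p => ⟨⟨p.1, p.2⟩, rfl⟩⟩

instance : SigmaCompactSpace (GL (Fin (n + 1)) ℝ) := by
  have : SigmaCompactSpace (Matrix (Fin (n + 1)) (Fin (n + 1)) ℝ) :=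
    inferInstanceAs (SigmaCompactSpace (Fin (n + 1) → Fin (n + 1) → ℝ))
  have : SigmaCompactSpace (Matrix (Fin (n + 1)) (Fin (n + 1)) ℝ)ᵐᵒᵖ :=
    MulOpposite.opHomeomorph.symm.isClosedEmbedding.sigmaCompactSpace
  exact Units.isClosedEmbedding_embedProduct.sigmaCompactSpace

instance : SigmaCompactSpace (Poincare n) := by
  have : SigmaCompactSpace (LorentzO n) :=
    isClosed_lorentzO.isClosedEmbedding_subtypeVal.sigmaCompactSpace
  have h : Topology.IsClosedEmbedding fun g : Poincare n => (g.lin, g.tr) :=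
    ⟨⟨isInducing_lin_tr, bijective_lin_tr.1⟩, by
      rw [bijective_lin_tr.2.range_eq]; exact isClosed_univ⟩
  exact h.sigmaCompactSpace

lemma lorentzB_mat (g : Poincare n) (x y : Fin (n + 1) → ℝ) :
    lorentzB n (g.mat *ᵥ x) (g.mat *ᵥ y) = lorentzB n x y := g.lin.2 x y

lemma lorentzB_eq_dotProduct (x y : Fin (n + 1) → ℝ) : lorentzB n x y =
    x ⬝ᵥ (diagonal (Fin.cons (-1) 1) : Matrix (Fin (n + 1)) (Fin (n + 1)) ℝ) *ᵥ y := by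
  simp [lorentzB, dotProduct, mulVec_diagonal, Fin.sum_univ_succ]

lemma det_mat_sq (g : Poincare n) : g.mat.det ^ 2 = 1 := by
  set J : Matrix (Fin (n + 1)) (Fin (n + 1)) ℝ := diagonal (Fin.cons (-1) 1) with hJ
  have h : g.matᵀ * J * g.mat = J := by
    refine Matrix.ext_of_mulVec_single fun j => ?_
    refine dotProduct_eq _ _ fun w => ?_
    rw [dotProduct_comm, dotProduct_comm _ w, ← lorentzB_eq_dotProduct, ← g.lorentzB_mat,
      lorentzB_eq_dotProduct, ← mulVec_mulVec, ← mulVec_mulVec, dotProduct_mulVec,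
      vecMul_transpose]
  have hd : J.det ≠ 0 := by
    rw [hJ, det_diagonal, Fin.prod_univ_succ]; simp
  have := congrArg det h
  rw [det_mul, det_mul, det_transpose] at this
  apply mul_right_cancel₀ hd
  rw [one_mul]
  linear_combination this

lemma map_smul_volume (g : Poincare n) : Measure.map (g • ·) (volume : Measure (Fin (n + 1) → ℝ))
    = volume := by
  have hdet : g.mat.det ≠ 0 := fun h => by simpa [h] using g.det_mat_sq
  have h1 := Real.map_matrix_volume_pi_eq_smul_volume_pi hdet
  have habs : |g.mat.det⁻¹| = 1 := by
    rw [abs_inv, inv_eq_one, ← abs_one, ← sq_eq_sq_iff_abs_eq_abs, g.det_mat_sq, one_pow]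
  rw [habs, ENNReal.ofReal_one, one_smul] at h1
  have h2 : ((g • ·) : (Fin (n + 1) → ℝ) → _) = (· + g.tr) ∘ (toLin' g.mat) := by
    funext x; simp [smul_def]
  rw [h2, ← Measure.map_map (measurable_add_const _)
    (toLin' g.mat).continuous_of_finiteDimensional.measurable, h1]
  exact map_add_right_eq_self _ _

/-- The linear part of a Poincaré transformation as a continuous linear map. -/
def linCLM (g : Poincare n) : (Fin (n + 1) → ℝ) →L[ℝ] (Fin (n + 1) → ℝ) :=
  LinearMap.toContinuousLinearMap (toLin' g.mat)

@[simp] lemma linCLM_apply (g : Poincare n) (v) : g.linCLM v = g.mat *ᵥ v := rfl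

lemma continuous_linCLM : Continuous (linCLM : Poincare n → _) :=
  ((toLin' (R := ℝ) (n := Fin (n + 1)) (m := Fin (n + 1))).trans
    LinearMap.toContinuousLinearMap).toLinearMap.continuous_of_finiteDimensional.comp
    continuous_mat

lemma linCLM_mul (g h : Poincare n) : (g * h).linCLM = g.linCLM * h.linCLM := by
  ext1 v
  simp [mat, matOf_mul, ← mulVec_mulVec]

lemma linCLM_one : (1 : Poincare n).linCLM = 1 := by
  ext1 v
  simp [mat, matOf_one]

theorem exists_isOrbitCocycle (L : Subgroup (Poincare n)) [MeasurableSpace L] [BorelSpace L]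
    (hunimod : ∀ μ : Measure L, μ.IsHaarMeasure → μ.IsMulRightInvariant)
    (htrans : ∀ x y : Fin (n + 1) → ℝ, ∃! g : L, (g : Poincare n) • x = y)
    (hclosed : IsClosed (L : Set (Poincare n))) :
    ∃ A I, IsOrbitCocycle (n := n) A I ∧ (∀ g ∈ L, A g.tr = g.linCLM) ∧
      ∀ x, ∃ g ∈ L, g.tr = x := by
  have : SigmaCompactSpace L := hclosed.isClosedEmbedding_subtypeVal.sigmaCompactSpace
  have : MulAction.IsPretransitive L (Fin (n + 1) → ℝ) := ⟨fun x y => (htrans x y).exists⟩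
  have : ContinuousSMul L (Fin (n + 1) → ℝ) :=
    ⟨((continuous_subtype_val.comp continuous_fst).smul continuous_snd :
      Continuous fun p : L × (Fin (n + 1) → ℝ) => (p.1 : Poincare n) • p.2)⟩
  have hopen := isOpenMap_smul_of_sigmaCompact (G := L) (0 : Fin (n + 1) → ℝ)
  have hbij : Function.Bijective fun g : L => g • (0 : Fin (n + 1) → ℝ) :=
    ⟨fun g h hgh => (htrans 0 (h • (0 : Fin (n + 1) → ℝ))).unique hgh rfl,
      fun x => (htrans 0 x).exists⟩
  have hcont : Continuous fun g : L => g • (0 : Fin (n + 1) → ℝ) := by fun_prop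
  set Φ : L ≃ₜ (Fin (n + 1) → ℝ) :=
    (Equiv.ofBijective _ hbij).toHomeomorphOfContinuousOpen hcont hopen with hΦ
  have hΦ0 : ∀ g : L, Φ g = g • (0 : Fin (n + 1) → ℝ) := fun g => rfl
  have hΦtr : ∀ g : L, Φ g = (g : Poincare n).tr := fun g => by
    rw [hΦ0, Subgroup.smul_def, smul_def]; simp
  have hΦmul : ∀ g h : L, Φ (g * h) = g • Φ h := fun g h => by
    rw [hΦ0, hΦ0, mul_smul]
  set A : (Fin (n + 1) → ℝ) → (Fin (n + 1) → ℝ) →L[ℝ] (Fin (n + 1) → ℝ) :=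
    fun x => (Φ.symm x : Poincare n).linCLM with hA
  set I : (Fin (n + 1) → ℝ) → (Fin (n + 1) → ℝ) →L[ℝ] (Fin (n + 1) → ℝ) :=
    fun x => ((Φ.symm x)⁻¹ : Poincare n).linCLM with hI
  have hact : ∀ x y, Φ.symm x • y = x + A x y := fun x y => by
    rw [Subgroup.smul_def, smul_def, ← hΦtr, Φ.apply_symm_apply, add_comm _ x]; rfl
  have hmul : ∀ x y, Φ.symm (x + A x y) = Φ.symm x * Φ.symm y := fun x y => by
    rw [Homeomorph.symm_apply_eq, hΦmul, Φ.apply_symm_apply, hact]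
  have hAc : Continuous A :=
    continuous_linCLM.comp (continuous_subtype_val.comp Φ.symm.continuous)
  have hIc : Continuous I :=
    continuous_linCLM.comp (continuous_subtype_val.comp Φ.symm.continuous).inv
  have hmap : ∀ x y, A (x + A x y) = A x * A y := fun x y => by
    simp only [hA] at hmul ⊢
    rw [hmul, Subgroup.coe_mul, linCLM_mul]
  have hAI : ∀ x, A x * I x = 1 := fun x => by
    simp only [hA, hI]
    rw [← linCLM_mul, mul_inv_cancel, linCLM_one]
  have hIA : ∀ x, I x * A x = 1 := fun x => by
    simp only [hA, hI]
    rw [← linCLM_mul, inv_mul_cancel, linCLM_one]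
  have hμ : (Measure.map Φ.symm volume).IsHaarMeasure :=
    { lt_top_of_isCompact := fun K hK => by
        rw [Φ.symm.measurableEmbedding.map_apply, ← Φ.image_eq_preimage_symm]
        exact (hK.image Φ.continuous).measure_lt_top
      map_mul_left_eq_self := fun g => by
        rw [Measure.map_map (measurable_const_mul g) Φ.symm.continuous.measurable]
        have : (g * ·) ∘ Φ.symm = Φ.symm ∘ ((g : Poincare n) • ·) := by
          funext x
          rw [Function.comp_apply, Function.comp_apply, eq_comm, Homeomorph.symm_apply_eq,
            hΦmul, Φ.apply_symm_apply]
          rfl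
        rw [this, ← Measure.map_map Φ.symm.continuous.measurable
          (continuous_const_smul _).measurable, map_smul_volume]
      open_pos := fun U hU hne => by
        rw [Φ.symm.measurableEmbedding.map_apply]
        exact (hU.preimage Φ.symm.continuous).measure_ne_zero _
          (hne.preimage Φ.symm.surjective) }
  have hpres : ∀ p, Measure.map (fun z => z + A z p) volume = volume := by
    intro p
    have h1 := (hunimod _ hμ).map_mul_right_eq_self (Φ.symm p)
    rw [Measure.map_map (measurable_mul_const _) Φ.symm.continuous.measurable] at h1
    have h2 := congrArg (Measure.map Φ) h1
    rw [Measure.map_map Φ.continuous.measurable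
      ((measurable_mul_const _).comp Φ.symm.continuous.measurable),
      Measure.map_map Φ.continuous.measurable Φ.symm.continuous.measurable,
      Φ.self_comp_symm, Measure.map_id] at h2
    have h3 : (fun z => z + A z p) = Φ ∘ (· * Φ.symm p) ∘ Φ.symm := by
      funext z
      rw [Function.comp_apply, Function.comp_apply, ← hmul, Φ.apply_symm_apply]
    rw [h3, h2]
  refine ⟨A, I, ⟨hmap, hAI, hIA, fun x => lorentzB_mat _, hAc,
    differentiableAt_of_measurePreserving hAc hIc hmap hAI hpres, fun x y hxy => ?_⟩,
    fun g hg => ?_, fun x => ⟨Φ.symm x, (Φ.symm x).2, ?_⟩⟩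
  · rw [add_comm _ x, ← hact] at hxy
    have : Φ.symm x = 1 := (htrans y y).unique hxy (one_smul _ y)
    rw [Homeomorph.symm_apply_eq, hΦtr] at this
    exact this
  · have : Φ.symm g.tr = ⟨g, hg⟩ := by rw [Homeomorph.symm_apply_eq, hΦtr]
    simp only [hA, this]
  · rw [← hΦtr, Φ.apply_symm_apply]

end Poincare

section LieKolchin

open scoped commutatorElement

lemma representation_apply_ne_zero {G E : Type*} [Group G] [AddCommGroup E] [Module ℂ E]
    (ρ : G →* Module.End ℂ E) (g : G) {v : E} (hv : v ≠ 0) : ρ g v ≠ 0 := by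
  intro h
  apply hv
  have h1 : ρ (g⁻¹ * g) v = ρ g⁻¹ (ρ g v) := by rw [map_mul]; rfl
  rw [h, map_zero, inv_mul_cancel, map_one] at h1
  exact h1

/-- An eigenvalue of a fixed operator depending continuously on a point of a connected set is
constant. -/
lemma eq_of_forall_hasEigenvalue {G E : Type*} [TopologicalSpace G] [AddCommGroup E] [Module ℂ E]
    [FiniteDimensional ℂ E] {S : Set G} (hS : IsPreconnected S) {φ : Module.End ℂ E}
    {f : G → ℂ} (hf : ContinuousOn f S) (h : ∀ g ∈ S, φ.HasEigenvalue (f g)) {a b : G}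
    (ha : a ∈ S) (hb : b ∈ S) : f a = f b := by
  have : Finite {c | φ.HasEigenvalue c} := Module.End.finite_hasEigenvalue φ
  exact hS.constant_of_mapsTo (T := {c | φ.HasEigenvalue c}) (Set.Finite.isDiscrete this) hf h
    ha hb

variable {G : Type*} [Group G] [TopologicalSpace G] [IsTopologicalGroup G]

lemma Subgroup.isPreconnected_closure {S : Set G} (hS : IsPreconnected S) (h1 : 1 ∈ S) :
    IsPreconnected (Subgroup.closure S : Set G) := by
  set K := Subgroup.closure S with hK
  have hSK : S ⊆ K := Subgroup.subset_closure
  have hpre : IsPreconnected ((↑) ⁻¹' S : Set K) := by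
    refine Topology.IsInducing.subtypeVal.isPreconnected_image.1 ?_
    convert hS
    ext g; simpa using fun hg => hSK hg
  have hsub : ((↑) ⁻¹' S : Set K) ⊆ connectedComponent 1 :=
    hpre.subset_connectedComponent (by simpa using h1)
  have htop : Subgroup.connectedComponentOfOne K = ⊤ := by
    rw [eq_top_iff, ← Subgroup.closure_closure_coe_preimage (k := S), Subgroup.closure_le]
    exact hsub
  have huniv : (connectedComponent 1 : Set K) = Set.univ :=
    congrArg (fun H : Subgroup K => (H : Set K)) htop
  have h2 : IsPreconnected (Set.univ : Set K) := huniv ▸ isPreconnected_connectedComponent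
  have := Topology.IsInducing.subtypeVal.isPreconnected_image.2 h2
  rwa [Set.image_univ, Subtype.range_coe] at this

lemma Subgroup.isPreconnected_commutator {H : Subgroup G} (hH : IsPreconnected (H : Set G)) :
    IsPreconnected ((⁅H, H⁆ : Subgroup G) : Set G) := by
  rw [Subgroup.commutator_def]
  refine Subgroup.isPreconnected_closure ?_ ⟨1, H.one_mem, 1, H.one_mem, by simp⟩
  have : {g | ∃ g₁ ∈ H, ∃ g₂ ∈ H, ⁅g₁, g₂⁆ = g}
      = (fun p : G × G => ⁅p.1, p.2⁆) '' ((H : Set G) ×ˢ (H : Set G)) := by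
    ext g
    simp only [Set.mem_ofPred_eq, Set.mem_image, Set.mem_prod, Prod.exists, SetLike.mem_coe]
    exact ⟨fun ⟨a, ha, b, hb, h⟩ => ⟨a, b, ⟨ha, hb⟩, h⟩,
      fun ⟨a, b, ⟨ha, hb⟩, h⟩ => ⟨a, ha, b, hb, h⟩⟩
  rw [this]
  refine (hH.prod hH).image _ ?_
  simp only [commutatorElement_def]
  fun_prop

lemma isPreconnected_derivedSeries [PreconnectedSpace G] (k : ℕ) :
    IsPreconnected (derivedSeries G k : Set G) := by
  induction k with
  | zero => simpa using isPreconnected_univ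
  | succ k ih => exact Subgroup.isPreconnected_commutator ih

variable {E : Type*} [NormedAddCommGroup E] [NormedSpace ℂ E] [FiniteDimensional ℂ E]
  (ρ : G →* Module.End ℂ E)

/-- Every nonzero invariant subspace contains a common eigenvector. -/
def HasCommonEigenvectors (H : Subgroup G) : Prop :=
  ∀ T : Submodule ℂ E, T ≠ ⊥ → (∀ h ∈ H, ∀ v ∈ T, ρ h v ∈ T) →
    ∃ v ∈ T, v ≠ 0 ∧ ∀ h ∈ H, ∃ c : ℂ, ρ h v = c • v

variable {ρ}

lemma HasCommonEigenvectors.of_commutator (hρ : ∀ v, Continuous fun g => ρ g v)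
    {H : Subgroup G} (hH : IsPreconnected (H : Set G)) (hc : HasCommonEigenvectors ρ ⁅H, H⁆) :
    HasCommonEigenvectors ρ H := by
  intro T₀ hT₀ hT₀inv
  have hmul : ∀ a b w, ρ (a * b) w = ρ a (ρ b w) := fun a b w => by rw [map_mul]; rfl
  obtain ⟨T, ⟨hTle, hT, hTinv⟩, hmin⟩ := (wellFounded_lt (α := Submodule ℂ E)).has_min
    {T | T ≤ T₀ ∧ T ≠ ⊥ ∧ ∀ h ∈ H, ∀ v ∈ T, ρ h v ∈ T} ⟨T₀, le_rfl, hT₀, hT₀inv⟩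
  have hmin' : ∀ W ≤ T, W ≠ ⊥ → (∀ h ∈ H, ∀ v ∈ W, ρ h v ∈ W) → W = T := by
    intro W hW hne hinv
    by_contra hWT
    exact hmin W ⟨hW.trans hTle, hne, hinv⟩ (lt_of_le_of_ne hW hWT)
  have hcH : ⁅H, H⁆ ≤ H := Subgroup.commutator_le_self H
  obtain ⟨v, hvT, hv0, hv⟩ := hc T hT fun h hh => hTinv h (hcH hh)
  obtain ⟨l, hl⟩ := SeparatingDual.exists_eq_one (R := ℂ) hv0
  set χ : G → ℂ := fun g => l (ρ g v) with hχ
  have hχc : Continuous χ := l.continuous.comp (hρ v)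
  have hχv : ∀ h ∈ ⁅H, H⁆, ρ h v = χ h • v := by
    intro h hh
    obtain ⟨c, hc⟩ := hv h hh
    rw [hχ]
    simp only [hc, map_smul, hl, smul_eq_mul, mul_one]
  have hconj : ∀ g ∈ H, ∀ h ∈ ⁅H, H⁆, g⁻¹ * h * g ∈ ⁅H, H⁆ := by
    intro g hg h hh
    have h1 : ⁅g⁻¹, h⁆ * h = g⁻¹ * h * g := by simp [commutatorElement_def]
    rw [← h1]
    exact mul_mem (Subgroup.commutator_mem_commutator (inv_mem hg) (hcH hh)) hh
  have hχconj : ∀ g ∈ H, ∀ h ∈ ⁅H, H⁆, χ (g⁻¹ * h * g) = χ h := by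
    intro g hg h hh
    have := eq_of_forall_hasEigenvalue hH (φ := ρ h) (f := fun g => χ (g⁻¹ * h * g))
      (by fun_prop) (fun g hg => ?_) hg H.one_mem
    · simpa using this
    · refine Module.End.hasEigenvalue_of_hasEigenvector (x := ρ g v)
        (Module.End.hasEigenvector_iff.2 ⟨?_, representation_apply_ne_zero ρ g hv0⟩)
      rw [Module.End.mem_eigenspace_iff, ← map_smul, ← hχv _ (hconj g hg h hh), ← hmul, ← hmul]
      congr 2; group
  set W : Submodule ℂ E := T ⊓ ⨅ h ∈ ⁅H, H⁆, (ρ h).eigenspace (χ h) with hW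
  have hWmem : ∀ w, w ∈ W ↔ w ∈ T ∧ ∀ h ∈ ⁅H, H⁆, ρ h w = χ h • w := by
    intro w; simp [hW, Submodule.mem_iInf]
  have hWT : W = T := by
    refine hmin' W inf_le_left (fun h => hv0 ?_) fun g hg w hw => ?_
    · rw [← Submodule.mem_bot ℂ, ← h, hWmem]
      exact ⟨hvT, hχv⟩
    · rw [hWmem] at hw ⊢
      refine ⟨hTinv g hg w hw.1, fun h hh => ?_⟩
      rw [← hχconj g hg h hh, ← map_smul, ← hw.2 _ (hconj g hg h hh), ← hmul, ← hmul]
      congr 2; group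
  have hscal : ∀ h ∈ ⁅H, H⁆, ∀ w ∈ T, ρ h w = χ h • w := by
    intro h hh w hw
    rw [← hWT, hWmem] at hw
    exact hw.2 h hh
  refine ⟨v, hTle hvT, hv0, fun a ha => ?_⟩
  have : Nontrivial T := Submodule.nontrivial_iff_ne_bot.2 hT
  obtain ⟨c, hc⟩ := Module.End.exists_eigenvalue ((ρ a).restrict (hTinv a ha))
  obtain ⟨⟨w, hwT⟩, hw⟩ := hc.exists_hasEigenvector
  have hw0 : w ≠ 0 := fun h => hw.2 (Subtype.ext h)
  have hwc : ρ a w = c • w := congrArg Subtype.val hw.apply_eq_smul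
  have hc0 : c ≠ 0 := by
    rintro rfl
    exact representation_apply_ne_zero ρ a hw0 (by rw [hwc, zero_smul])
  have hcomm : ∀ b ∈ H, ∀ u ∈ T, ρ a (ρ b u) = χ ⁅a, b⁆ • ρ b (ρ a u) := by
    intro b hb u hu
    rw [← hscal _ (Subgroup.commutator_mem_commutator ha hb) _
      (hTinv b hb _ (hTinv a ha u hu)), ← hmul, ← hmul, ← hmul]
    congr 2; simp [commutatorElement_def]
  have hone : ∀ b ∈ H, χ ⁅a, b⁆ = 1 := by
    intro b hb
    have := eq_of_forall_hasEigenvalue hH (φ := ρ a) (f := fun b => χ ⁅a, b⁆ * c)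
      (by simp only [commutatorElement_def]; fun_prop) (fun b hb => ?_) hb H.one_mem
    · have h1 : χ 1 = 1 := by simp [hχ, hl]
      simp only [commutatorElement_one_right, h1] at this
      exact mul_right_cancel₀ hc0 this
    · refine Module.End.hasEigenvalue_of_hasEigenvector (x := ρ b w)
        (Module.End.hasEigenvector_iff.2 ⟨?_, representation_apply_ne_zero ρ b hw0⟩)
      rw [Module.End.mem_eigenspace_iff, hcomm b hb w hwT, hwc, map_smul, smul_smul]
  have hU : T ⊓ (ρ a).eigenspace c = T := by
    refine hmin' _ inf_le_left (fun h => hw0 ?_) fun b hb u hu => ?_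
    · rw [← Submodule.mem_bot ℂ, ← h]
      exact ⟨hwT, Module.End.mem_eigenspace_iff.2 hwc⟩
    · refine ⟨hTinv b hb u hu.1, Module.End.mem_eigenspace_iff.2 ?_⟩
      rw [hcomm b hb u hu.1, hone b hb, one_smul, Module.End.mem_eigenspace_iff.1 hu.2, map_smul]
  have hva : v ∈ T ⊓ (ρ a).eigenspace c := hU.symm ▸ hvT
  exact ⟨c, Module.End.mem_eigenspace_iff.1 hva.2⟩

/-- The Lie–Kolchin theorem for connected solvable topological groups. -/
theorem exists_common_eigenvector [PreconnectedSpace G] [hG : Group.IsSolvable G]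
    (hρ : ∀ v, Continuous fun g => ρ g v) {T : Submodule ℂ E} (hT : T ≠ ⊥)
    (hinv : ∀ g, ∀ v ∈ T, ρ g v ∈ T) :
    ∃ v ∈ T, v ≠ 0 ∧ ∀ g, ∃ c : ℂ, ρ g v = c • v := by
  obtain ⟨N, hN⟩ := hG.solvable
  have key : ∀ j ≤ N, HasCommonEigenvectors ρ (derivedSeries G (N - j)) := by
    intro j
    induction j with
    | zero =>
      intro _ T hT _
      obtain ⟨v, hvT, hv0⟩ := Submodule.exists_mem_ne_zero_of_ne_bot hT
      refine ⟨v, hvT, hv0, fun h hh => ⟨1, ?_⟩⟩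
      rw [Nat.sub_zero, hN, Subgroup.mem_bot] at hh
      simp [hh]
    | succ j ih =>
      intro hj
      refine .of_commutator hρ (isPreconnected_derivedSeries _) ?_
      have := ih (Nat.le_of_succ_le hj)
      rwa [show N - j = N - (j + 1) + 1 by omega, derivedSeries_succ] at this
  have h0 := key N le_rfl
  rw [Nat.sub_self, derivedSeries_zero] at h0
  obtain ⟨v, hvT, hv0, hv⟩ := h0 T hT fun g _ => hinv g
  exact ⟨v, hvT, hv0, fun g => hv g trivial⟩

end LieKolchin

section Complexification

variable {m : Type*} [Fintype m]

lemma re_map_mulVec (A : Matrix m m ℝ) (z : m → ℂ) :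
    (fun i => ((A.map Complex.ofReal *ᵥ z) i).re) = A *ᵥ fun i => (z i).re := by
  funext i; simp [mulVec, dotProduct]

lemma im_map_mulVec (A : Matrix m m ℝ) (z : m → ℂ) :
    (fun i => ((A.map Complex.ofReal *ᵥ z) i).im) = A *ᵥ fun i => (z i).im := by
  funext i; simp [mulVec, dotProduct]

/-- The complexification of a subspace of `ℝ^m`, as a subspace of `ℂ^m`. -/
def Submodule.complexify {m : Type*} (S : Submodule ℝ (m → ℝ)) : Submodule ℂ (m → ℂ) where
  carrier := {z | (fun i => (z i).re) ∈ S ∧ (fun i => (z i).im) ∈ S}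
  add_mem' h k := ⟨S.add_mem h.1 k.1, S.add_mem h.2 k.2⟩
  zero_mem' := ⟨S.zero_mem, S.zero_mem⟩
  smul_mem' c z h := by
    refine ⟨?_, ?_⟩
    · convert S.sub_mem (S.smul_mem c.re h.1) (S.smul_mem c.im h.2) using 1
      funext i; simp
    · convert S.add_mem (S.smul_mem c.re h.2) (S.smul_mem c.im h.1) using 1
      funext i; simp

/-- A connected solvable group of real matrices has a common complex eigenvector in every nonzero
invariant subspace. -/
lemma exists_complex_eigenvector [DecidableEq m] {G : Type*} [Group G] [TopologicalSpace G] [IsTopologicalGroup G]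
    [PreconnectedSpace G] [Group.IsSolvable G] {M : G →* Matrix m m ℝ} (hM : Continuous M)
    {S : Submodule ℝ (m → ℝ)} (hS : S ≠ ⊥) (hinv : ∀ g, ∀ v ∈ S, M g *ᵥ v ∈ S) :
    ∃ c : G → ℂ, Continuous c ∧ c 1 = 1 ∧ ∃ a ∈ S, ∃ b ∈ S, (a ≠ 0 ∨ b ≠ 0) ∧
      (∀ g, M g *ᵥ a = (c g).re • a - (c g).im • b) ∧
      ∀ g, M g *ᵥ b = (c g).im • a + (c g).re • b := by
  set ρ : G →* Module.End ℂ (m → ℂ) :=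
    ((toLinAlgEquiv' : Matrix m m ℂ ≃ₐ[ℂ] _) : Matrix m m ℂ →* Module.End ℂ (m → ℂ)).comp
      ((Complex.ofRealHom.mapMatrix : Matrix m m ℝ →+* Matrix m m ℂ).toMonoidHom.comp M) with hρ
  have hρapp : ∀ g z, ρ g z = (M g).map Complex.ofReal *ᵥ z := fun g z => rfl
  have hρc : ∀ z, Continuous fun g => ρ g z := by
    intro z
    simp only [hρapp]
    exact (hM.matrix_map Complex.continuous_ofReal).matrix_mulVec continuous_const
  obtain ⟨u, huS, hu0⟩ := Submodule.exists_mem_ne_zero_of_ne_bot hS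
  obtain ⟨z, hzT, hz0, hz⟩ := exists_common_eigenvector hρc (T := S.complexify)
    (fun h => hu0 (by
      have h1 : (fun i => (u i : ℂ)) ∈ S.complexify :=
        ⟨huS, S.zero_mem⟩
      rw [h, Submodule.mem_bot] at h1
      funext i
      simpa using congrFun h1 i))
    (fun g v hv => ⟨by rw [hρapp, re_map_mulVec]; exact hinv g _ hv.1,
      by rw [hρapp, im_map_mulVec]; exact hinv g _ hv.2⟩)
  obtain ⟨l, hl⟩ := SeparatingDual.exists_eq_one (R := ℂ) hz0
  have hc : ∀ g, (M g).map Complex.ofReal *ᵥ z = l (ρ g z) • z := by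
    intro g
    obtain ⟨c, hc⟩ := hz g
    rw [← hρapp, hc, map_smul, hl, smul_eq_mul, mul_one]
  refine ⟨fun g => l (ρ g z), l.continuous.comp (hρc z), by simp [hl], _, hzT.1, _, hzT.2, ?_,
    fun g => ?_, fun g => ?_⟩
  · by_contra! h
    exact hz0 (funext fun i => Complex.ext (congrFun h.1 i) (congrFun h.2 i))
  · rw [← re_map_mulVec, hc]
    rfl
  · rw [← im_map_mulVec, hc]
    funext i
    simp [add_comm]

end Complexification

section NullVector

open lorentzB

variable {n : ℕ} {G : Type*} [Group G] [TopologicalSpace G] [IsTopologicalGroup G]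
    [PreconnectedSpace G] [Group.IsSolvable G] {M : G →* Matrix (Fin (n + 1)) (Fin (n + 1)) ℝ}

lemma exists_fixed_or_null_eigenvector_of_timelike (hM : Continuous M)
    (hB : ∀ g x y, lorentzB n (M g *ᵥ x) (M g *ᵥ y) = lorentzB n x y)
    (S : Submodule ℝ (Fin (n + 1) → ℝ)) (hinv : ∀ g, ∀ v ∈ S, M g *ᵥ v ∈ S)
    (hS : ∃ u ∈ S, lorentzB n u u < 0) :
    (∃ v ≠ 0, ∀ g, M g *ᵥ v = v) ∨
      ∃ e ≠ 0, lorentzB n e e = 0 ∧ ∀ g, ∃ c : ℝ, M g *ᵥ e = c • e := by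
  induction S using WellFoundedLT.induction with
  | ind S ih =>
  obtain ⟨u, huS, hu⟩ := hS
  have hSbot : S ≠ ⊥ := by
    rintro rfl
    rw [(Submodule.mem_bot ℝ).1 huS, zero_left] at hu
    exact lt_irrefl _ hu
  obtain ⟨c, hcc, hc1, a, haS, b, hbS, hab, ha, hb⟩ := exists_complex_eigenvector hM hSbot hinv
  have hBaa := fun g => hB g a a
  have hBab := fun g => hB g a b
  have hBbb := fun g => hB g b b
  simp only [ha, hb, sub_left, sub_right, add_left, add_right, smul_left, smul_right, symm b a]
    at hBaa hBab hBbb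
  by_cases hQ : lorentzB n a a = lorentzB n b b ∧ lorentzB n a b = 0
  · obtain ⟨hα, hγ⟩ := hQ
    rcases le_or_gt (lorentzB n a a) 0 with hneg | hpos
    · right
      by_cases ha0 : a = 0
      · refine ⟨b, hab.resolve_left (not_not.2 ha0), by rw [← hα, ha0, zero_left], fun g => ?_⟩
        exact ⟨(c g).re, by rw [hb, ha0, smul_zero, zero_add]⟩
      · obtain ⟨k, hk⟩ := exists_eq_smul_of_nonpos ha0 hneg (hα ▸ hneg) hγ
        refine ⟨a, ha0, ?_, fun g => ⟨(c g).re - (c g).im * k, ?_⟩⟩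
        · rw [hk, smul_right] at hγ
          rcases mul_eq_zero.1 hγ with h0 | h0
          · rw [hα, hk, h0, zero_smul, zero_left]
          · exact h0
        · rw [ha, hk, smul_smul, sub_smul]
    · set S' : Submodule ℝ (Fin (n + 1) → ℝ) := S ⊓ (LinearMap.ker (toCLM n a).toLinearMap ⊓
        LinearMap.ker (toCLM n b).toLinearMap) with hS'
      have hmem : ∀ v, v ∈ S' ↔ v ∈ S ∧ lorentzB n a v = 0 ∧ lorentzB n b v = 0 := by
        intro v; simp [hS']
      refine ih S' (lt_of_le_of_ne inf_le_left fun h => ?_) (fun g v hv => ?_) ?_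
      · have := (hmem a).1 (h ▸ haS)
        exact hpos.ne' this.2.1
      · rw [hmem] at hv ⊢
        have hadj : ∀ w, lorentzB n w (M g *ᵥ v) = lorentzB n (M g⁻¹ *ᵥ w) v := by
          intro w
          rw [← hB g⁻¹, mulVec_mulVec, ← map_mul, inv_mul_cancel, map_one, one_mulVec]
        refine ⟨hinv g v hv.1, ?_, ?_⟩
        · rw [hadj, ha, sub_left, smul_left, smul_left, hv.2.1, hv.2.2]; ring
        · rw [hadj, hb, add_left, smul_left, smul_left, hv.2.1, hv.2.2]; ring
      · set α := lorentzB n a a with hα'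
        refine ⟨u - (lorentzB n u a / α) • a - (lorentzB n u b / α) • b,
          (hmem _).2 ⟨S.sub_mem (S.sub_mem huS (S.smul_mem _ haS)) (S.smul_mem _ hbS), ?_, ?_⟩, ?_⟩
        · rw [sub_right, sub_right, smul_right, smul_right, hγ, ← hα', symm a u]
          field_simp; ring
        · rw [sub_right, sub_right, smul_right, smul_right, symm b a, hγ, ← hα, symm b u]
          field_simp; ring
        · have h1 : lorentzB n (u - (lorentzB n u a / α) • a - (lorentzB n u b / α) • b)
              (u - (lorentzB n u a / α) • a - (lorentzB n u b / α) • b)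
              = lorentzB n u u - lorentzB n u a ^ 2 / α - lorentzB n u b ^ 2 / α := by
            simp only [sub_left, sub_right, smul_left, smul_right, symm b a, symm a u, symm b u,
              hγ, ← hα, ← hα']
            field_simp; ring
          rw [h1]
          have h2 : 0 ≤ lorentzB n u a ^ 2 / α := by positivity
          have h3 : 0 ≤ lorentzB n u b ^ 2 / α := by positivity
          linarith
  · left
    set Q : ℂ := ⟨lorentzB n a a - lorentzB n b b, 2 * lorentzB n a b⟩ with hQ'
    have hQ0 : Q ≠ 0 := by
      intro h
      have h1 := congrArg Complex.re h
      have h2 := congrArg Complex.im h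
      simp only [hQ', Complex.zero_re, Complex.zero_im] at h1 h2
      exact hQ ⟨by linarith, by linarith⟩
    have hsq : ∀ g, c g = 1 ∨ c g = -1 := by
      intro g
      rw [← sq_eq_one_iff]
      apply mul_right_cancel₀ hQ0
      rw [one_mul]
      apply Complex.ext
      · simp only [hQ', sq, Complex.mul_re, Complex.mul_im]
        linear_combination hBaa g - hBbb g
      · simp only [hQ', sq, Complex.mul_re, Complex.mul_im]
        linear_combination 2 * hBab g
    have hfin : ({1, -1} : Set ℂ).Finite := by simp
    have hone : ∀ g, c g = 1 := by
      intro g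
      rw [← hc1]
      exact isPreconnected_univ.constant_of_mapsTo hfin.isDiscrete hcc.continuousOn
        (fun g _ => by simpa using hsq g) trivial trivial
    rcases hab with h0 | h0
    · exact ⟨a, h0, fun g => by rw [ha, hone]; simp⟩
    · exact ⟨b, h0, fun g => by rw [hb, hone]; simp⟩

/-- A connected solvable group of Lorentz transformations fixes a nonzero vector or preserves a
null line. -/
lemma exists_fixed_or_null_eigenvector (hM : Continuous M)
    (hB : ∀ g x y, lorentzB n (M g *ᵥ x) (M g *ᵥ y) = lorentzB n x y) :
    (∃ v ≠ 0, ∀ g, M g *ᵥ v = v) ∨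
      ∃ e, e 0 = 1 ∧ lorentzB n e e = 0 ∧ ∀ g, ∃ c : ℝ, M g *ᵥ e = c • e := by
  refine (exists_fixed_or_null_eigenvector_of_timelike hM hB ⊤ (fun _ _ _ => trivial)
    ⟨Pi.single 0 1, trivial, by simp [single_zero_right]⟩).imp_right ?_
  rintro ⟨e, he0, hnull, he⟩
  have h0 : e 0 ≠ 0 := fun h => he0 (eq_zero_of_self_nonpos h hnull.le)
  refine ⟨(e 0)⁻¹ • e, by simp [h0], by rw [smul_left, smul_right, hnull]; ring, fun g => ?_⟩
  obtain ⟨c, hc⟩ := he g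
  exact ⟨c, by rw [mulVec_smul, hc, smul_comm]⟩

end NullVector

lemma IsOrbitCocycle.exists_fixed_of_null_eigenvector {n : ℕ}
    {A I : (Fin (n + 1) → ℝ) → (Fin (n + 1) → ℝ) →L[ℝ] (Fin (n + 1) → ℝ)}
    (hA : IsOrbitCocycle A I) {e : Fin (n + 1) → ℝ} (e_zero : e 0 = 1)
    (e_null : lorentzB n e e = 0) (he : ∀ x, ∃ c : ℝ, A x e = c • e) :
    ∃ v ≠ 0, ∀ x, A x v = v := by
  have hχ : ∀ x, A x e = (A x e 0) • e := by
    intro x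
    obtain ⟨c, hc⟩ := he x
    simp [hc, e_zero]
  have hne : ∀ x, A x e 0 ≠ 0 := by
    intro x h
    have := hA.inv_apply x e
    rw [hχ, h, zero_smul, _root_.map_zero] at this
    simp [← this] at e_zero
  have hcont : Continuous fun x => A x e 0 :=
    (continuous_apply 0).comp (hA.cont.clm_apply continuous_const)
  have hpos : ∀ x, 0 < A x e 0 := by
    intro x
    by_contra! h
    obtain ⟨y, hy⟩ := mem_range_of_exists_le_of_exists_ge hcont ⟨x, h⟩
      ⟨0, by rw [hA.map_zero_apply, e_zero]; exact zero_le_one⟩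
    exact hne y hy
  obtain ⟨h, hN⟩ := IsNullCocycle.exists_of_map_e hA e_zero e_null hpos hχ
  exact hN.exists_fixed

end

open MeasureTheory in
/-- A connected solvable unimodular (closed) Lie subgroup `L` of the Poincaré
group `O(1,n) ⋉ ℝ^{n+1}` acting simply transitively on `ℝ^{n+1}` has linear part fixing a
nonzero vector; equivalently, `L` preserves a nonzero constant vector field on `ℝ^{n+1}`. -/
theorem unimodular_solvable_simply_transitive_fixes_vector
    (n : ℕ) (L : Subgroup (Poincare n))
    [MeasurableSpace ↥L] [BorelSpace ↥L]
    (hclosed : IsClosed (L : Set (Poincare n)))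
    (hconn : IsConnected (L : Set (Poincare n)))
    (hsolv : IsSolvable ↥L)
    (hunimod : ∀ μ : Measure ↥L, μ.IsHaarMeasure → μ.IsMulRightInvariant)
    (htrans : ∀ x y : Fin (n + 1) → ℝ, ∃! g : ↥L, (g : Poincare n) • x = y) :
    ∃ v : Fin (n + 1) → ℝ, v ≠ 0 ∧ ∀ g ∈ L, (Poincare.mat g).mulVec v = v := by
  obtain ⟨A, I, hA, hAL, htr⟩ := Poincare.exists_isOrbitCocycle L hunimod htrans hclosed
  have : ConnectedSpace L := isConnected_iff_connectedSpace.1 hconn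
  have : Group.IsSolvable L := hsolv
  let M : L →* Matrix (Fin (n + 1)) (Fin (n + 1)) ℝ :=
    { toFun := fun g => (g : Poincare n).mat
      map_one' := rfl
      map_mul' := fun _ _ => rfl }
  rcases exists_fixed_or_null_eigenvector (M := M)
    (Poincare.continuous_mat.comp continuous_subtype_val) (fun g => Poincare.lorentzB_mat _)
    with ⟨v, hv0, hv⟩ | ⟨e, e_zero, e_null, he⟩
  · exact ⟨v, hv0, fun g hg => hv ⟨g, hg⟩⟩
  · obtain ⟨v, hv0, hv⟩ := hA.exists_fixed_of_null_eigenvector e_zero e_null fun x => by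
      obtain ⟨g, hg, rfl⟩ := htr x
      rw [hAL g hg]
      exact he ⟨g, hg⟩
    refine ⟨v, hv0, fun g hg => ?_⟩
    rw [← Poincare.linCLM_apply, ← hAL g hg, hv]
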